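/- Let n ≥ 2 and let p_1, …, p_n be points in the Euclidean plane. For every i with 2 ≤ i ≤ n−1, the minimum lengths A(·,·) of partial tours satisfy the recurrence: (a) for every j with 1 ≤ j < i, A(i+1, j) = A(i, j) + dist(p_i, p_{i+1}); and (b) A(i+1, i) = min over 1 ≤ k < i of ( A(i, k) + dist(p_k, p_{i+1}) ). -/

import Mathlib

noncomputable section

/-- Points in the Euclidean plane. -/
abbrev Pt := EuclideanSpace ℝ (Fin 2)

/-- The pairs `(x, x')` of elements of `X` with `x < x'` that are consecutive in `X`,
i.e. no element of `X` lies strictly between them. -/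
def consecPairs (X : Finset ℕ) : Finset (ℕ × ℕ) :=
  (X ×ˢ X).filter fun q => q.1 < q.2 ∧ ∀ y ∈ X, ¬ (q.1 < y ∧ y < q.2)

/-- The chain length of `X`: the sum of the distances between consecutive elements of `X`. -/
def chainLen (p : ℕ → Pt) (X : Finset ℕ) : ℝ :=
  ∑ q ∈ consecPairs X, dist (p q.1) (p q.2)

/-- `(S, T)` is an `(i,j)`-partial tour: `S ∪ T = {1,…,i}`, `S ∩ T = {1}`,
`max S = i` and `max T = j`. -/
def IsPartialTour (i j : ℕ) (S T : Finset ℕ) : Prop :=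
  S ∪ T = Finset.Icc 1 i ∧ S ∩ T = {1} ∧ S.max = (i : WithBot ℕ) ∧ T.max = (j : WithBot ℕ)

/-- `A i j`: the minimum length of an `(i,j)`-partial tour. -/
def tourA (p : ℕ → Pt) (i j : ℕ) : ℝ :=
  sInf {L : ℝ | ∃ S T : Finset ℕ, IsPartialTour i j S T ∧ L = chainLen p S + chainLen p T}

theorem max_iff (X : Finset ℕ) (m : ℕ) :
    X.max = (m : WithBot ℕ) ↔ m ∈ X ∧ ∀ x ∈ X, x ≤ m := by
  constructor
  · intro h
    exact ⟨Finset.mem_of_max h, fun x hx => Finset.le_max_of_eq hx h⟩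
  · rintro ⟨h1, h2⟩
    apply le_antisymm
    · exact Finset.max_le fun x hx => WithBot.coe_le_coe.2 (h2 x hx)
    · exact Finset.le_max h1

theorem tour_iff (i j : ℕ) (S T : Finset ℕ) : IsPartialTour i j S T ↔
    (∀ x, (x ∈ S ∨ x ∈ T) ↔ (1 ≤ x ∧ x ≤ i)) ∧ (∀ x, (x ∈ S ∧ x ∈ T) ↔ x = 1) ∧
    (i ∈ S ∧ ∀ x ∈ S, x ≤ i) ∧ (j ∈ T ∧ ∀ x ∈ T, x ≤ j) := by
  unfold IsPartialTour
  rw [max_iff, max_iff, Finset.ext_iff, Finset.ext_iff]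
  simp only [Finset.mem_union, Finset.mem_inter, Finset.mem_Icc, Finset.mem_singleton]

theorem chain_insert (p : ℕ → Pt) (X : Finset ℕ) (m a : ℕ) (hm : m ∈ X) (hX : ∀ x ∈ X, x ≤ m)
    (ha : m < a) : chainLen p (insert a X) = chainLen p X + dist (p m) (p a) := by
  have h : consecPairs (insert a X) = insert (m, a) (consecPairs X) := by
    ext ⟨x, y⟩
    simp only [consecPairs, Finset.mem_filter, Finset.mem_product, Finset.mem_insert,
      Prod.mk.injEq]
    constructor
    · rintro ⟨⟨hx, hy⟩, hxy, hb⟩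
      grind
    · rintro (⟨rfl, rfl⟩ | ⟨⟨hx, hy⟩, hxy, hb⟩)
      · grind
      · grind
  have h2 : (m, a) ∉ consecPairs X := by
    simp only [consecPairs, Finset.mem_filter, Finset.mem_product]
    grind
  unfold chainLen
  rw [h, Finset.sum_insert h2, add_comm]

theorem chain_nonneg (p : ℕ → Pt) (X : Finset ℕ) : 0 ≤ chainLen p X :=
  Finset.sum_nonneg fun _ _ => dist_nonneg

theorem tourA_le (p : ℕ → Pt) (i j : ℕ) (S T : Finset ℕ) (h : IsPartialTour i j S T) :
    tourA p i j ≤ chainLen p S + chainLen p T := by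
  apply csInf_le
  · refine ⟨0, ?_⟩
    rintro _ ⟨S, T, _, rfl⟩
    exact add_nonneg (chain_nonneg p S) (chain_nonneg p T)
  · exact ⟨S, T, h, rfl⟩

theorem le_tourA (p : ℕ → Pt) (i j : ℕ) (hj : 1 ≤ j) (hji : j < i) (c : ℝ)
    (h : ∀ S T, IsPartialTour i j S T → c ≤ chainLen p S + chainLen p T) : c ≤ tourA p i j := by
  apply le_csInf
  · refine ⟨_, (Finset.Icc 1 i).filter (fun x => x = 1 ∨ x ≠ j), {1, j}, ?_, rfl⟩
    rw [tour_iff]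
    simp only [Finset.mem_filter, Finset.mem_Icc, Finset.mem_insert, Finset.mem_singleton]
    grind
  · rintro _ ⟨S, T, hST, rfl⟩
    exact h S T hST

theorem tourA_nonneg (p : ℕ → Pt) (i j : ℕ) : 0 ≤ tourA p i j := by
  apply Real.sInf_nonneg
  rintro _ ⟨S, T, _, rfl⟩
  exact add_nonneg (chain_nonneg p S) (chain_nonneg p T)

theorem stmt_0 (n : ℕ) (hn : 2 ≤ n) (p : ℕ → Pt) (i : ℕ) (hi2 : 2 ≤ i) (hi : i ≤ n - 1) :
    (∀ j, 1 ≤ j → j < i →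
        tourA p (i + 1) j = tourA p i j + dist (p i) (p (i + 1))) ∧
    tourA p (i + 1) i =
      sInf {x : ℝ | ∃ k, 1 ≤ k ∧ k < i ∧ x = tourA p i k + dist (p k) (p (i + 1))} := by
  refine ⟨?_, ?_⟩
  · intro j hj hji
    apply le_antisymm
    · rw [← sub_le_iff_le_add]
      apply le_tourA p i j hj hji
      intro S T h
      have h' := (tour_iff _ _ _ _).1 h
      have ht : IsPartialTour (i + 1) j (insert (i + 1) S) T := by
        rw [tour_iff]
        simp only [Finset.mem_insert]
        grind
      have := tourA_le p _ _ _ _ ht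
      rw [chain_insert p S i (i + 1) h'.2.2.1.1 h'.2.2.1.2 (by omega)] at this
      linarith
    · apply le_tourA p (i + 1) j hj (by omega)
      intro S T h
      have h' := (tour_iff _ _ _ _).1 h
      have ht : IsPartialTour i j (S.erase (i + 1)) T := by
        rw [tour_iff]
        simp only [Finset.mem_erase]
        grind
      have h'' := (tour_iff _ _ _ _).1 ht
      have := tourA_le p _ _ _ _ ht
      have e := chain_insert p _ i (i + 1) h''.2.2.1.1 h''.2.2.1.2 (by omega)
      rw [Finset.insert_erase h'.2.2.1.1] at e
      linarith
  · apply le_antisymm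
    · apply le_csInf
      · exact ⟨_, 1, le_refl _, by omega, rfl⟩
      · rintro _ ⟨k, hk, hki, rfl⟩
        rw [← sub_le_iff_le_add]
        apply le_tourA p i k hk hki
        intro S T h
        have h' := (tour_iff _ _ _ _).1 h
        have ht : IsPartialTour (i + 1) i (insert (i + 1) T) S := by
          rw [tour_iff]
          simp only [Finset.mem_insert]
          grind
        have := tourA_le p _ _ _ _ ht
        rw [chain_insert p T k (i + 1) h'.2.2.2.1 h'.2.2.2.2 (by omega)] at this
        linarith
    · apply le_tourA p (i + 1) i (by omega) (by omega)
      intro S T h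
      have h' := (tour_iff _ _ _ _).1 h
      have h1 : 1 ∈ S.erase (i + 1) := by
        rw [Finset.mem_erase]
        grind
      obtain ⟨k, hk⟩ := Finset.max_of_mem h1
      obtain ⟨hk1, hk2⟩ := (max_iff _ _).1 hk
      have hk3 : 1 ≤ k := hk2 1 h1
      have hk4 : k < i := by
        have := hk1
        rw [Finset.mem_erase] at this
        grind
      have ht : IsPartialTour i k T (S.erase (i + 1)) := by
        rw [tour_iff]
        refine ⟨?_, ?_, h'.2.2.2, hk1, hk2⟩
        · simp only [Finset.mem_erase]
          grind
        · simp only [Finset.mem_erase]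
          grind
      have h2 := tourA_le p _ _ _ _ ht
      have e := chain_insert p _ k (i + 1) hk1 hk2 (by omega)
      rw [Finset.insert_erase h'.2.2.1.1] at e
      have h3 : sInf {x : ℝ | ∃ k, 1 ≤ k ∧ k < i ∧ x = tourA p i k + dist (p k) (p (i + 1))} ≤
          tourA p i k + dist (p k) (p (i + 1)) := by
        apply csInf_le
        · refine ⟨0, ?_⟩
          rintro _ ⟨k, _, _, rfl⟩
          exact add_nonneg (tourA_nonneg p i k) dist_nonneg
        · exact ⟨k, hk3, hk4, rfl⟩
      linarith
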